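/- Let Ω be a probability space, p ≥ 1, and let C : Ω → Matrix (Fin p) (Fin p) ℝ be a random real symmetric p×p matrix such that C, tr(C)·C, tr(C²) and tr(C)² are integrable, with M₀ := E[C] and η₀ := tr(M₀)/p. Assume E[‖C − (tr(C)/p)·I‖_F²] > 0, and let β₀ := ‖M₀ − η₀·I‖_F² / E[‖C − (tr(C)/p)·I‖_F²]. Then the minimum value of the mean squared error is E[‖β₀·C + (1−β₀)·(tr(C)/p)·I − M₀‖_F²] = (E[tr(C)²] − tr(M₀)²)/p + (1 − β₀)·‖M₀ − η₀·I‖_F². -/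

import Mathlib

open MeasureTheory ProbabilityTheory Matrix

/-- Squared Frobenius norm of a real matrix: `‖A‖_F² = tr(AᵀA)`. -/
noncomputable def frobSq {p : ℕ} (A : Matrix (Fin p) (Fin p) ℝ) : ℝ := (Aᵀ * A).trace

theorem frobSq_sub_smul_one {p : ℕ} (A : Matrix (Fin p) (Fin p) ℝ) (t : ℝ) :
    frobSq (A - t • (1 : Matrix (Fin p) (Fin p) ℝ)) =
      frobSq A - 2 * t * A.trace + p * t ^ 2 := by
  simp only [frobSq, transpose_sub, transpose_smul, transpose_one, sub_mul, mul_sub, smul_mul,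
    Matrix.mul_smul, Matrix.one_mul, Matrix.mul_one, trace_sub, trace_smul, trace_transpose,
    trace_one, Fintype.card_fin, smul_eq_mul]
  ring

theorem frobSq_smul_sub {p : ℕ} (A B : Matrix (Fin p) (Fin p) ℝ) (b : ℝ) :
    frobSq (b • A - B) = b ^ 2 * frobSq A - 2 * b * (Bᵀ * A).trace + frobSq B := by
  have h : (Aᵀ * B).trace = (Bᵀ * A).trace := by
    rw [← trace_transpose, transpose_mul, transpose_transpose]
  simp only [frobSq, transpose_sub, transpose_smul, sub_mul, mul_sub, smul_mul, Matrix.mul_smul,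
    trace_sub, trace_smul, smul_eq_mul, h]
  ring

/-- The loss of the shrinkage estimator splits into its trace-free part and its trace part. -/
theorem frobSq_shrinkage_sub {p : ℕ} (hp : (p : ℝ) ≠ 0) (A M : Matrix (Fin p) (Fin p) ℝ)
    (b : ℝ) :
    frobSq (b • A + (1 - b) • ((A.trace / p) • (1 : Matrix (Fin p) (Fin p) ℝ)) - M) =
      b ^ 2 * frobSq (A - (A.trace / p) • (1 : Matrix (Fin p) (Fin p) ℝ))
        - 2 * b * ((M - (M.trace / p) • (1 : Matrix (Fin p) (Fin p) ℝ))ᵀ * A).trace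
        + frobSq (M - (M.trace / p) • (1 : Matrix (Fin p) (Fin p) ℝ))
        + (A.trace ^ 2 - 2 * M.trace * A.trace + M.trace ^ 2) / p := by
  have h : b • A + (1 - b) • ((A.trace / p) • (1 : Matrix (Fin p) (Fin p) ℝ)) - M =
      (b • A - M) - (-((1 - b) * (A.trace / p))) • (1 : Matrix (Fin p) (Fin p) ℝ) := by
    rw [neg_smul, mul_smul]
    abel
  rw [h, frobSq_sub_smul_one, frobSq_smul_sub, frobSq_sub_smul_one, frobSq_sub_smul_one]
  simp only [transpose_sub, transpose_smul, transpose_one, sub_mul, smul_mul, Matrix.one_mul,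
    trace_sub, trace_smul, smul_eq_mul]
  field_simp
  ring

theorem trace_transpose_sub_smul_one_mul_self {p : ℕ} (hp : (p : ℝ) ≠ 0)
    (M : Matrix (Fin p) (Fin p) ℝ) :
    ((M - (M.trace / p) • (1 : Matrix (Fin p) (Fin p) ℝ))ᵀ * M).trace =
      frobSq (M - (M.trace / p) • (1 : Matrix (Fin p) (Fin p) ℝ)) := by
  rw [frobSq_sub_smul_one]
  simp only [frobSq, transpose_sub, transpose_smul, transpose_one, sub_mul, smul_mul,
    Matrix.one_mul, trace_sub, trace_smul, smul_eq_mul]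
  field_simp
  ring

section Expectation

variable {Ω : Type*} [MeasurableSpace Ω] {μ : Measure Ω} {p : ℕ}
  {C : Ω → Matrix (Fin p) (Fin p) ℝ}

theorem integrable_trace_mul (hC : ∀ a b, Integrable (fun ω => C ω a b) μ)
    (B : Matrix (Fin p) (Fin p) ℝ) : Integrable (fun ω => (B * C ω).trace) μ := by
  simp only [trace, diag_apply, mul_apply]
  exact integrable_finsetSum _ fun i _ => integrable_finsetSum _ fun j _ =>
    (hC j i).const_mul (B i j)

theorem integral_trace_mul (hC : ∀ a b, Integrable (fun ω => C ω a b) μ)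
    {M : Matrix (Fin p) (Fin p) ℝ} (hM : ∀ a b, M a b = ∫ ω, C ω a b ∂μ)
    (B : Matrix (Fin p) (Fin p) ℝ) : ∫ ω, (B * C ω).trace ∂μ = (B * M).trace := by
  simp only [trace, diag_apply, mul_apply]
  rw [integral_finsetSum _ fun i _ => integrable_finsetSum _ fun j _ =>
    (hC j i).const_mul (B i j)]
  refine Finset.sum_congr rfl fun i _ => ?_
  rw [integral_finsetSum _ fun j _ => (hC j i).const_mul (B i j)]
  exact Finset.sum_congr rfl fun j _ => by rw [integral_const_mul, hM]

end Expectation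

/-- **Theorem 1 (optimal MSE value, equation (14)).** For a random symmetric `p×p` matrix `C`
with mean `M₀ = E[C]`, `η₀ = tr(M₀)/p`, and
`β₀ = ‖M₀ − η₀·I‖_F² / E[‖C − (tr(C)/p)·I‖_F²]` (assuming the denominator is positive),
the minimum mean squared error is
`E[‖β₀·C + (1−β₀)·(tr(C)/p)·I − M₀‖_F²] = (E[tr(C)²] − tr(M₀)²)/p + (1−β₀)·‖M₀ − η₀·I‖_F²`. -/
theorem shrinkage_mse_optimal_value
    {Ω : Type*} [MeasureSpace Ω] [IsProbabilityMeasure (ℙ : Measure Ω)]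
    {p : ℕ} (hp : 1 ≤ p)
    (C : Ω → Matrix (Fin p) (Fin p) ℝ)
    (hCsymm : ∀ ω, (C ω).IsSymm)
    (hCint : ∀ a b, Integrable (fun ω => C ω a b))
    (htrCCint : ∀ a b, Integrable (fun ω => (C ω).trace * C ω a b))
    (htrC2int : Integrable (fun ω => (C ω * C ω).trace))
    (htrCsqint : Integrable (fun ω => (C ω).trace ^ 2))
    (M₀ : Matrix (Fin p) (Fin p) ℝ) (hM₀ : ∀ a b, M₀ a b = ∫ ω, C ω a b)
    (η₀ : ℝ) (hη₀ : η₀ = M₀.trace / p)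
    (hden : 0 < ∫ ω, frobSq (C ω - ((C ω).trace / p) • (1 : Matrix (Fin p) (Fin p) ℝ)))
    (β₀ : ℝ)
    (hβ₀ : β₀ = frobSq (M₀ - η₀ • (1 : Matrix (Fin p) (Fin p) ℝ))
        / ∫ ω, frobSq (C ω - ((C ω).trace / p) • (1 : Matrix (Fin p) (Fin p) ℝ))) :
    (∫ ω, frobSq (β₀ • C ω + (1 - β₀) • (((C ω).trace / p) • (1 : Matrix (Fin p) (Fin p) ℝ))
          - M₀))
      = ((∫ ω, (C ω).trace ^ 2) - M₀.trace ^ 2) / p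
        + (1 - β₀) * frobSq (M₀ - η₀ • (1 : Matrix (Fin p) (Fin p) ℝ)) := by
  have hp' : (p : ℝ) ≠ 0 := by exact_mod_cast (show p ≠ 0 by omega)
  subst hη₀
  have hA : Integrable (fun ω =>
      frobSq (C ω - ((C ω).trace / p) • (1 : Matrix (Fin p) (Fin p) ℝ))) := by
    by_contra h
    exact hden.ne' (integral_undef h)
  set N := M₀ - (M₀.trace / p) • (1 : Matrix (Fin p) (Fin p) ℝ) with hN
  have hNC := integrable_trace_mul hCint Nᵀ
  have hNC_int := integral_trace_mul hCint hM₀ Nᵀ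
  have htr : Integrable (fun ω => (C ω).trace) := by
    simpa using integrable_trace_mul hCint 1
  have htr_int : ∫ ω, (C ω).trace = M₀.trace := by
    simpa using integral_trace_mul hCint hM₀ 1
  rw [hN, trace_transpose_sub_smul_one_mul_self hp', ← hN] at hNC_int
  simp_rw [frobSq_shrinkage_sub hp', ← hN]
  have h₁ := (hA.const_mul (β₀ ^ 2)).sub (hNC.const_mul (2 * β₀))
  have h₂ := h₁.add (integrable_const (frobSq N))
  have h₃ := htrCsqint.sub (htr.const_mul (2 * M₀.trace))
  have h₄ := (h₃.add (integrable_const (M₀.trace ^ 2))).div_const (p : ℝ)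
  simp only [Pi.add_def, Pi.sub_def] at h₁ h₂ h₃ h₄
  rw [integral_add h₂ h₄, integral_add h₁ (integrable_const _),
    integral_sub (hA.const_mul _) (hNC.const_mul _), integral_div,
    integral_add h₃ (integrable_const _), integral_sub htrCsqint (htr.const_mul _)]
  simp only [integral_const_mul, integral_const, probReal_univ, one_smul, hNC_int, htr_int]
  rw [eq_div_iff hden.ne'] at hβ₀
  linear_combination β₀ * hβ₀
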